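/- Let A be an abelian category in which every monomorphism splits, and let f : X ⟶ Y be a morphism in A. Regard X and Y as cochain complexes concentrated in degree 0. Then the mapping cone of the induced map of cochain complexes is homotopy equivalent to the cochain complex having ker(f) in cohomological degree −1, coker(f) in cohomological degree 0, zero in all other degrees, and all differentials zero. (That is, in the homotopy category, Cone(f) ≅ ker(f)[1] ⊕ coker(f).) -/

import Mathlib

open CategoryTheory CategoryTheory.Limits ZeroObject

universe v u

/-- The cochain complex with `kernel f` in cohomological degree `-1`, `cokernel f` in degree
`0`, zero elsewhere, and all differentials zero. -/
noncomputable def kernelCokernelComplex {A : Type u} [Category.{v} A] [Abelian A]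
    {X Y : A} (f : X ⟶ Y) : CochainComplex A ℤ where
  X n := if n = -1 then kernel f else if n = 0 then cokernel f else 0
  d _ _ := 0
  shape _ _ _ := rfl

namespace CategoryTheory.Abelian

variable {A : Type u} [Category.{v} A] [Abelian A]

/-- If every monomorphism splits, then every morphism `f` has a pseudo-inverse `h` such that
`1 - f h` and `1 - h f` are the projections onto the kernel and the cokernel of `f`. -/
lemma exists_kernel_cokernel_splitting
    (hsplit : ∀ {P Q : A} (g : P ⟶ Q), Mono g → IsSplitMono g) {X Y : A} (f : X ⟶ Y) :
    ∃ (r : X ⟶ kernel f) (s : cokernel f ⟶ Y) (h : Y ⟶ X),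
      kernel.ι f ≫ r = 𝟙 _ ∧ s ≫ cokernel.π f = 𝟙 _ ∧
      f ≫ h + r ≫ kernel.ι f = 𝟙 X ∧ h ≫ f + cokernel.π f ≫ s = 𝟙 Y := by
  have := hsplit (kernel.ι f) inferInstance
  have := hsplit (Abelian.factorThruCoimage f) inferInstance
  let r := retraction (kernel.ι f)
  have hr : kernel.ι f ≫ r = 𝟙 _ := IsSplitMono.id _
  let h : Y ⟶ X := retraction (Abelian.factorThruCoimage f) ≫
    cokernel.desc (kernel.ι f) (𝟙 X - r ≫ kernel.ι f) (by simp [reassoc_of% hr])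
  have hfh : f ≫ h = 𝟙 X - r ≫ kernel.ι f := by
    calc f ≫ h = (Abelian.coimage.π f ≫ Abelian.factorThruCoimage f) ≫ h := by
          rw [Abelian.coimage.fac]
      _ = 𝟙 X - r ≫ kernel.ι f := by
          rw [Category.assoc, IsSplitMono.id_assoc, cokernel.π_desc]
  have hfhf : f ≫ (𝟙 Y - h ≫ f) = 0 := by
    simp [reassoc_of% hfh, Preadditive.sub_comp]
  refine ⟨r, cokernel.desc f (𝟙 Y - h ≫ f) hfhf, h, hr, ?_, by simp [hfh], by simp⟩
  rw [← cancel_epi (cokernel.π f)]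
  simp [Preadditive.sub_comp]

end CategoryTheory.Abelian

namespace CochainComplex

variable {A : Type u} [Category.{v} A] [Preadditive A] {K L : CochainComplex A ℤ}

/-- A morphism to a complex concentrated in degrees `-1` and `0`, with source also concentrated
in these degrees, given by its two components. -/
noncomputable def homOfTwoTerm (hK : ∀ n, n ≠ -1 → n ≠ 0 → IsZero (K.X n))
    (hL : ∀ n, n ≠ -1 → n ≠ 0 → IsZero (L.X n))
    (p : K.X (-1) ⟶ L.X (-1)) (q : K.X 0 ⟶ L.X 0) (comm : p ≫ L.d (-1) 0 = K.d (-1) 0 ≫ q) :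
    K ⟶ L where
  f n := if h : n = -1 then (K.XIsoOfEq h).hom ≫ p ≫ (L.XIsoOfEq h).inv
    else if h : n = 0 then (K.XIsoOfEq h).hom ≫ q ≫ (L.XIsoOfEq h).inv else 0
  comm' i j hij := by
    obtain rfl : i + 1 = j := hij
    by_cases hi : i = -1
    · subst hi
      simpa using comm
    by_cases hi' : i = 0
    · subst hi'
      exact (hL _ (by simp) (by simp)).eq_of_tgt _ _
    · exact (hK _ hi hi').eq_of_src _ _

section

variable (hK : ∀ n, n ≠ -1 → n ≠ 0 → IsZero (K.X n))
  (hL : ∀ n, n ≠ -1 → n ≠ 0 → IsZero (L.X n))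
  (p : K.X (-1) ⟶ L.X (-1)) (q : K.X 0 ⟶ L.X 0) (comm : p ≫ L.d (-1) 0 = K.d (-1) 0 ≫ q)

@[simp]
lemma homOfTwoTerm_f_neg_one : (homOfTwoTerm hK hL p q comm).f (-1) = p := by
  simp [homOfTwoTerm]

@[simp]
lemma homOfTwoTerm_f_zero : (homOfTwoTerm hK hL p q comm).f 0 = q := by
  simp [homOfTwoTerm]

end

/-- A homotopy between morphisms whose source is concentrated in degrees `-1` and `0`, given by
its component from degree `0` to degree `-1`. -/
noncomputable def homotopyOfTwoTerm (hK : ∀ n, n ≠ -1 → n ≠ 0 → IsZero (K.X n))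
    {φ ψ : K ⟶ L} (h : K.X 0 ⟶ L.X (-1))
    (h₁ : φ.f (-1) = K.d (-1) 0 ≫ h + ψ.f (-1)) (h₀ : φ.f 0 = h ≫ L.d (-1) 0 + ψ.f 0) :
    Homotopy φ ψ where
  hom i j := if hij : i = 0 ∧ j = -1 then
    (K.XIsoOfEq hij.1).hom ≫ h ≫ (L.XIsoOfEq hij.2).inv else 0
  zero i j hij := dif_neg (by rintro ⟨rfl, rfl⟩; exact hij (by simp))
  comm n := by
    by_cases hn : n = -1
    · subst hn
      rw [dNext_eq _ (show (ComplexShape.up ℤ).Rel (-1) 0 by simp),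
        prevD_eq _ (show (ComplexShape.up ℤ).Rel (-2) (-1) by simp)]
      simpa using h₁
    by_cases hn' : n = 0
    · subst hn'
      rw [dNext_eq _ (show (ComplexShape.up ℤ).Rel 0 1 by simp),
        prevD_eq _ (show (ComplexShape.up ℤ).Rel (-1) 0 by simp)]
      simpa using h₀
    · exact (hK _ hn hn').eq_of_src _ _

section

variable {X Y : A} (f : X ⟶ Y)

lemma isZero_mappingCone_single_X [HasZeroObject A] [HasBinaryBiproducts A]
    (n : ℤ) (hn : n ≠ -1) (hn' : n ≠ 0) :
    IsZero ((mappingCone ((HomologicalComplex.single A (ComplexShape.up ℤ) 0).map f)).X n) := by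
  rw [mappingCone.isZero_X_iff]
  exact ⟨HomologicalComplex.isZero_single_obj_X _ _ _ _ (by omega),
    HomologicalComplex.isZero_single_obj_X _ _ _ _ hn'⟩

/-- In degree `-1`, the mapping cone of a morphism `X ⟶ Y` in degree `0` is `X`. -/
noncomputable def mappingConeSingleXNegOneIso [HasZeroObject A] [HasBinaryBiproducts A] :
    (mappingCone ((HomologicalComplex.single A (ComplexShape.up ℤ) 0).map f)).X (-1) ≅ X where
  hom := (mappingCone.fst _).1.v (-1) 0 (by simp) ≫
    (HomologicalComplex.singleObjXSelf (ComplexShape.up ℤ) 0 X).hom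
  inv := (HomologicalComplex.singleObjXSelf (ComplexShape.up ℤ) 0 X).inv ≫
    (mappingCone.inl _).v 0 (-1) (by simp)
  hom_inv_id := by
    apply mappingCone.ext_to _ (-1) 0 (by simp)
    · simp
    · exact (HomologicalComplex.isZero_single_obj_X _ _ _ _ (by simp)).eq_of_tgt _ _

/-- In degree `0`, the mapping cone of a morphism `X ⟶ Y` in degree `0` is `Y`. -/
noncomputable def mappingConeSingleXZeroIso [HasZeroObject A] [HasBinaryBiproducts A] :
    (mappingCone ((HomologicalComplex.single A (ComplexShape.up ℤ) 0).map f)).X 0 ≅ Y where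
  hom := (mappingCone.snd _).v 0 0 (by simp) ≫
    (HomologicalComplex.singleObjXSelf (ComplexShape.up ℤ) 0 Y).hom
  inv := (HomologicalComplex.singleObjXSelf (ComplexShape.up ℤ) 0 Y).inv ≫
    (mappingCone.inr _).f 0
  hom_inv_id := by
    apply mappingCone.ext_to _ 0 1 (by simp)
    · exact (HomologicalComplex.isZero_single_obj_X _ _ _ _ (by simp)).eq_of_tgt _ _
    · simp

lemma mappingCone_single_d [HasZeroObject A] [HasBinaryBiproducts A] :
    (mappingCone ((HomologicalComplex.single A (ComplexShape.up ℤ) 0).map f)).d (-1) 0 =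
      (mappingConeSingleXNegOneIso f).hom ≫ f ≫ (mappingConeSingleXZeroIso f).inv := by
  rw [← Iso.inv_comp_eq]
  simp [mappingConeSingleXNegOneIso, mappingConeSingleXZeroIso,
    mappingCone.inl_v_d _ 0 (-1) 1 (by simp) (by simp),
    HomologicalComplex.single_map_f_self]

end

end CochainComplex

section

variable {A : Type u} [Category.{v} A] [Abelian A] {X Y : A} (f : X ⟶ Y)

lemma isZero_kernelCokernelComplex_X (n : ℤ) (hn : n ≠ -1) (hn' : n ≠ 0) :
    IsZero ((kernelCokernelComplex f).X n) := by
  simpa [kernelCokernelComplex, hn, hn'] using isZero_zero A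

@[simp]
lemma kernelCokernelComplex_d (i j : ℤ) : (kernelCokernelComplex f).d i j = 0 := rfl

/-- The term in degree `-1` of `kernelCokernelComplex f` is `kernel f`. -/
noncomputable def kernelCokernelComplexXNegOneIso :
    (kernelCokernelComplex f).X (-1) ≅ kernel f :=
  eqToIso (by simp [kernelCokernelComplex])

/-- The term in degree `0` of `kernelCokernelComplex f` is `cokernel f`. -/
noncomputable def kernelCokernelComplexXZeroIso :
    (kernelCokernelComplex f).X 0 ≅ cokernel f :=
  eqToIso (by simp [kernelCokernelComplex])

end

/-- Let `A` be an abelian category in which every monomorphism splits, and let `f : X ⟶ Y`.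
Then the mapping cone of the map of cochain complexes induced by `f` between the complexes
concentrated in degree `0` is homotopy equivalent to the complex with `kernel f` in degree
`-1`, `cokernel f` in degree `0`, and zero differentials; i.e. in the homotopy category
`Cone(f) ≅ ker(f)[1] ⊕ coker(f)`. -/
theorem mappingCone_homotopyEquiv_kernelCokernel
    (A : Type u) [Category.{v} A] [Abelian A]
    (hsplit : ∀ {P Q : A} (g : P ⟶ Q), Mono g → IsSplitMono g)
    {X Y : A} (f : X ⟶ Y) :
    Nonempty (HomotopyEquiv
      (CochainComplex.mappingCone ((HomologicalComplex.single A (ComplexShape.up ℤ) 0).map f))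
      (kernelCokernelComplex f)) := by
  obtain ⟨r, s, h, hr, hs, hX, hY⟩ := Abelian.exists_kernel_cokernel_splitting hsplit f
  let eX := CochainComplex.mappingConeSingleXNegOneIso f
  let eY := CochainComplex.mappingConeSingleXZeroIso f
  let eK := kernelCokernelComplexXNegOneIso f
  let eC := kernelCokernelComplexXZeroIso f
  have hd := CochainComplex.mappingCone_single_d f
  have hM := CochainComplex.isZero_mappingCone_single_X f
  have hL := isZero_kernelCokernelComplex_X f
  refine ⟨{
    hom := CochainComplex.homOfTwoTerm hM hL (eX.hom ≫ r ≫ eK.inv)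
      (eY.hom ≫ cokernel.π f ≫ eC.inv) (by simp [hd, eY])
    inv := CochainComplex.homOfTwoTerm hL hM (eK.hom ≫ kernel.ι f ≫ eX.inv)
      (eC.hom ≫ s ≫ eY.inv) (by simp [hd, eX])
    homotopyHomInvId := (CochainComplex.homotopyOfTwoTerm hM (eY.hom ≫ h ≫ eX.inv) ?_ ?_).symm
    homotopyInvHomId := CochainComplex.homotopyOfTwoTerm hL 0 ?_ ?_ }⟩
  · have := eX.hom ≫= hX =≫ eX.inv
    simpa [hd, eY, eX] using this.symm
  · have := eY.hom ≫= hY =≫ eY.inv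
    simpa [hd, eY, eX] using this.symm
  · simp [reassoc_of% hr]
  · simp [reassoc_of% hs]
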